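/- Let (Λ, ξ) be a decorated D-lattice of dimension N ≡ 4 (mod 8), N = 8k+4. If w₁, w₂ ∈ Λ are non-proportional unigonal vectors (w_i² = -2, div(w_i) = 2) spanning a negative definite sublattice, then w₁ ⊥ w₂, ⟨w₁,w₂⟩ ≅ D₂, Λ = ⟨w₁,w₂⟩ ⊕ ⟨w₁,w₂⟩^⊥ with ⟨w₁,w₂⟩^⊥ ≅ II_{2,N-2}, and the classes w₁*, w₂* are the two distinct elements of A_Λ \ {0, ξ}. -/

import Mathlib

noncomputable section

open scoped BigOperators

/-- `x` has integer entries. -/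
def IntVec {n : ℕ} (x : Fin n → ℚ) : Prop := ∀ i, ∃ a : ℤ, x i = (a : ℚ)

/-- The lattice `D_n = {x ∈ ℤⁿ : Σ xᵢ ≡ 0 mod 2}` (viewed inside `ℚⁿ`),
equipped with the negative of the Euclidean form `negE`. -/
def DSet (n : ℕ) : Set (Fin n → ℚ) :=
  {x | IntVec x ∧ ∃ a : ℤ, (∑ i, x i) = 2 * (a : ℚ)}

/-- The negative of the standard Euclidean bilinear form. -/
def negE {n : ℕ} (x y : Fin n → ℚ) : ℚ := - ∑ i, x i * y i

/-- The vector `(1/2, …, 1/2)`. -/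
def halfVec (n : ℕ) : Fin n → ℚ := fun _ => 1/2

/-- The lattice `Λ_N = U² ⊕ D_{N-2}` realized inside `ℚ^{N+2}`: integral vectors whose
coordinates of index `≥ 4` have even sum.  The first four coordinates carry the two
hyperbolic planes. -/
def LamSet (N : ℕ) : Set (Fin (N + 2) → ℚ) :=
  {x | IntVec x ∧ ∃ a : ℤ, (∑ i : Fin (N + 2), if 4 ≤ (i : ℕ) then x i else 0) = 2 * (a : ℚ)}

/-- The bilinear form of `Λ_N = U² ⊕ D_{N-2}`. -/
def LamForm (N : ℕ) (x y : Fin (N + 2) → ℚ) : ℚ :=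
  x 0 * y 1 + x 1 * y 0 + x 2 * y 3 + x 3 * y 2
    - ∑ i : Fin (N + 2), (if 4 ≤ (i : ℕ) then x i * y i else 0)

/-- The (negative definite) `E₈` lattice inside `ℚ⁸`: vectors that are integral or
half-integral, with even coordinate sum; the form is `negE`. -/
def E8Set : Set (Fin 8 → ℚ) :=
  {x | (IntVec x ∨ IntVec (x - halfVec 8)) ∧ ∃ a : ℤ, (∑ i, x i) = 2 * (a : ℚ)}

/-- Ambient space for the even unimodular lattice `II_{2,2+8k} = U² ⊕ E₈^k`. -/
abbrev IIAmb (k : ℕ) := (Fin 4 → ℚ) × (Fin k → Fin 8 → ℚ)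

/-- The form of `U²` on `ℚ⁴`. -/
def UForm (x y : Fin 4 → ℚ) : ℚ := x 0 * y 1 + x 1 * y 0 + x 2 * y 3 + x 3 * y 2

/-- The bilinear form of `II_{2,2+8k} = U² ⊕ E₈^k`. -/
def IIForm (k : ℕ) (x y : IIAmb k) : ℚ := UForm x.1 y.1 + ∑ j, negE (x.2 j) (y.2 j)

/-- The even unimodular lattice `II_{2,2+8k} = U² ⊕ E₈^k` inside its ambient space. -/
def IISet (k : ℕ) : Set (IIAmb k) := {p | IntVec p.1 ∧ ∀ j, p.2 j ∈ E8Set}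

/-- `v` has divisibility `d` in `Λ_N`: all pairings with lattice vectors are divisible
by `d`, and `d` is attained. -/
def HasDiv (N : ℕ) (v : Fin (N + 2) → ℚ) (d : ℤ) : Prop :=
  (∀ x ∈ LamSet N, ∃ a : ℤ, LamForm N v x = (d : ℚ) * a) ∧
  ∃ x ∈ LamSet N, LamForm N v x = (d : ℚ)

/-- `ξ` represents a decoration of `Λ_N`: an element of the dual lattice whose class in
the discriminant group has square `1` modulo `2ℤ`. -/
def IsDeco (N : ℕ) (ξ : Fin (N + 2) → ℚ) : Prop :=
  (∀ y ∈ LamSet N, ∃ a : ℤ, LamForm N ξ y = (a : ℚ)) ∧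
  ∃ a : ℤ, LamForm N ξ ξ = 1 + 2 * (a : ℚ)

section Abstract

variable {V : Type*} [AddCommGroup V] [Module ℚ V]

/-- The Eichler transvection attached to `e` and `a`, as a linear map. -/
def eich (B : V →ₗ[ℚ] V →ₗ[ℚ] ℚ) (e a : V) : V →ₗ[ℚ] V :=
  LinearMap.id - (B a).smulRight e + (B e).smulRight a - (B e).smulRight ((B a a / 2) • e)

theorem eich_apply (B : V →ₗ[ℚ] V →ₗ[ℚ] ℚ) (e a x : V) :
    eich B e a x = x - B a x • e + B e x • a - B e x • ((B a a / 2) • e) := by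
  simp [eich]

theorem eich_inv (B : V →ₗ[ℚ] V →ₗ[ℚ] ℚ) (hB : ∀ x y, B x y = B y x) (e a : V)
    (he : B e e = 0) (hea : B e a = 0) (x : V) : eich B e (-a) (eich B e a x) = x := by
  have hae : B a e = 0 := by rw [hB, hea]
  simp only [eich_apply, map_add, map_sub, map_neg, map_smul, LinearMap.neg_apply,
    he, hea, hae]
  module

/-- The transvection as a linear equivalence. -/
def eichE (B : V →ₗ[ℚ] V →ₗ[ℚ] ℚ) (hB : ∀ x y, B x y = B y x) (e a : V)
    (he : B e e = 0) (hea : B e a = 0) : V ≃ₗ[ℚ] V :=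
  LinearEquiv.ofLinearMap (eich B e a) (eich B e (-a))
    (by
      ext x
      have := eich_inv B hB e (-a) he (by simp [hea]) x
      simpa using this)
    (by
      ext x
      exact eich_inv B hB e a he hea x)

/-- Isometries preserving `L` and fixing the orthogonal complement of `K`. -/
def GoodIso (B : V →ₗ[ℚ] V →ₗ[ℚ] ℚ) (L K : AddSubgroup V) (g : V ≃ₗ[ℚ] V) : Prop :=
  (∀ x y, B (g x) (g y) = B x y) ∧ (∀ x ∈ L, g x ∈ L) ∧ (∀ x ∈ L, g.symm x ∈ L) ∧
    (∀ x ∈ K, g x ∈ K) ∧ ∀ x, (∀ y ∈ K, B y x = 0) → g x = x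

theorem GoodIso.trans {B : V →ₗ[ℚ] V →ₗ[ℚ] ℚ} {L K : AddSubgroup V} {g h : V ≃ₗ[ℚ] V}
    (hg : GoodIso B L K g) (hh : GoodIso B L K h) : GoodIso B L K (g.trans h) := by
  obtain ⟨a1, a2, a3, a4, a5⟩ := hg
  obtain ⟨b1, b2, b3, b4, b5⟩ := hh
  refine ⟨fun x y => ?_, fun x hx => ?_, fun x hx => ?_, fun x hx => ?_, fun x hx => ?_⟩
  · simp [a1, b1]
  · exact b2 _ (a2 _ hx)
  · exact a3 _ (b3 _ hx)
  · exact b4 _ (a4 _ hx)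
  · simp [a5 x hx, b5 x hx]

theorem int_smul_mem (L : AddSubgroup V) {x : V} (hx : x ∈ L) (c : ℚ) (n : ℤ) (h : c = n) :
    c • x ∈ L := by
  subst h
  rw [Int.cast_smul_eq_zsmul]
  exact L.zsmul_mem hx n

theorem eich_mem (B : V →ₗ[ℚ] V →ₗ[ℚ] ℚ) (L K M : AddSubgroup V)
    (hKM : K ≤ M) (hML : M ≤ L)
    (hint : ∀ x ∈ K, ∀ y ∈ L, ∃ n : ℤ, B x y = n)
    (heven : ∀ x ∈ K, ∃ n : ℤ, B x x = 2 * n)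
    (e a : V) (heK : e ∈ K) (haK : a ∈ K) (x : V) (hx : x ∈ M) : eich B e a x ∈ M := by
  rw [eich_apply]
  obtain ⟨n1, h1⟩ := hint a haK x (hML hx)
  obtain ⟨n2, h2⟩ := hint e heK x (hML hx)
  obtain ⟨n3, h3⟩ := heven a haK
  refine M.sub_mem (M.add_mem (M.sub_mem hx (int_smul_mem M (hKM heK) _ n1 h1))
    (int_smul_mem M (hKM haK) _ n2 h2)) ?_
  refine int_smul_mem M (int_smul_mem M (hKM heK) _ n3 ?_) _ n2 h2
  rw [h3]; ring

theorem eichE_good (B : V →ₗ[ℚ] V →ₗ[ℚ] ℚ) (hB : ∀ x y, B x y = B y x) (L K : AddSubgroup V)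
    (hKL : K ≤ L)
    (hint : ∀ x ∈ K, ∀ y ∈ L, ∃ n : ℤ, B x y = n)
    (heven : ∀ x ∈ K, ∃ n : ℤ, B x x = 2 * n)
    (e a : V) (he : B e e = 0) (hea : B e a = 0) (heK : e ∈ K) (haK : a ∈ K) :
    GoodIso B L K (eichE B hB e a he hea) := by
  have hae : B a e = 0 := by rw [hB, hea]
  refine ⟨fun x y => ?_, fun x hx => ?_, fun x hx => ?_, fun x hx => ?_, fun x hx => ?_⟩
  · change B (eich B e a x) (eich B e a y) = _
    simp only [eich_apply, map_add, map_sub, map_smul, LinearMap.add_apply, LinearMap.sub_apply,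
      LinearMap.smul_apply, smul_eq_mul, he, hea, hae]
    rw [hB x e, hB x a]
    ring
  · exact eich_mem B L K L hKL le_rfl hint heven e a heK haK x hx
  · exact eich_mem B L K L hKL le_rfl hint heven e (-a) heK (K.neg_mem haK) x hx
  · exact eich_mem B L K K le_rfl hKL hint heven e a heK haK x hx
  · change eich B e a x = x
    rw [eich_apply, hx e heK, hx a haK]
    simp

/-- `(e, f)` and `(e', f')` are orthogonal hyperbolic pairs in `K`, orthogonal to `r`. -/
structure HypPairs (B : V →ₗ[ℚ] V →ₗ[ℚ] ℚ) (K : AddSubgroup V) (r e f e' f' : V) : Prop where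
  he : e ∈ K
  hf : f ∈ K
  he' : e' ∈ K
  hf' : f' ∈ K
  ee : B e e = 0
  ff : B f f = 0
  ef : B e f = 1
  ee2 : B e' e' = 0
  ff2 : B f' f' = 0
  ef2 : B e' f' = 1
  x1 : B e e' = 0
  x2 : B e f' = 0
  x3 : B f e' = 0
  x4 : B f f' = 0
  r1 : B e r = 0
  r2 : B f r = 0
  r3 : B e' r = 0
  r4 : B f' r = 0

theorem HypPairs.swap {B : V →ₗ[ℚ] V →ₗ[ℚ] ℚ} (hB : ∀ x y, B x y = B y x) {K : AddSubgroup V}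
    {r e f e' f' : V} (h : HypPairs B K r e f e' f') : HypPairs B K r e' f' e f :=
  ⟨h.he', h.hf', h.he, h.hf, h.ee2, h.ff2, h.ef2, h.ee, h.ff, h.ef,
    by rw [hB, h.x1], by rw [hB, h.x3], by rw [hB, h.x2], by rw [hB, h.x4], h.r3, h.r4, h.r1, h.r2⟩

/-- Final step of the Eichler criterion. -/
theorem eichler_zero (B : V →ₗ[ℚ] V →ₗ[ℚ] ℚ) (hB : ∀ x y, B x y = B y x) (L K : AddSubgroup V)
    (hKL : K ≤ L)
    (hint : ∀ x ∈ K, ∀ y ∈ L, ∃ n : ℤ, B x y = n)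
    (heven : ∀ x ∈ K, ∃ n : ℤ, B x x = 2 * n)
    (r e f e' f' : V) (H : HypPairs B K r e f e' f') (hrK : r ∈ K) (hr : B r r = -2)
    (u : V) (hu : u ∈ K) (hv : B (r + (2 : ℚ) • u) (r + (2 : ℚ) • u) = -2)
    (h0 : B f' u = 0) :
    ∃ g, GoodIso B L K g ∧ g (r + (2 : ℚ) • u) = r := by
  obtain ⟨q, hq⟩ := hint e' H.he' u (hKL hu)
  have hfe' : B f' e' = 1 := by rw [hB, H.ef2]
  have hre : B r e' = 0 := by rw [hB, H.r3]
  have hrf : B r f' = 0 := by rw [hB, H.r4]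
  set v := r + (2 : ℚ) • u with hvdef
  have hvK : v ∈ K := K.add_mem hrK (int_smul_mem K hu 2 2 (by norm_num))
  have hfv : B f' v = 0 := by simp [hvdef, h0, H.r4]
  have hvf : B v f' = 0 := by rw [hB, hfv]
  have hev : B e' v = 2 * q := by simp [hvdef, hq, H.r3]
  -- first transvection
  set a := (1 - q : ℚ) • (v - (2 * q : ℚ) • f') with ha
  have haK : a ∈ K := int_smul_mem K (K.sub_mem hvK (int_smul_mem K H.hf' _ (2 * q)
    (by push_cast; ring))) _ (1 - q) (by push_cast; ring)
  have hfa : B f' a = 0 := by simp [ha, hfv, H.ff2]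
  have g1 := eichE_good B hB L K hKL hint heven f' a H.ff2 hfa H.hf' haK
  have e1 : eichE B hB f' a H.ff2 hfa v = v + (2 * (1 - q) : ℚ) • f' := by
    change eich B f' a v = _
    rw [eich_apply, hfv]
    have : B a v = - 2 * (1 - q) := by
      simp [ha, hv, hfv]; ring
    rw [this]; module
  -- second transvection
  set u1 := u + (1 - q : ℚ) • f' with hu1
  have hv1 : v + (2 * (1 - q) : ℚ) • f' = r + (2 : ℚ) • u1 := by
    rw [hvdef, hu1]; module
  have hu1K : u1 ∈ K := K.add_mem hu (int_smul_mem K H.hf' _ (1 - q) (by push_cast; ring))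
  set b := f' - u1 with hb
  have hbK : b ∈ K := K.sub_mem H.hf' hu1K
  have heb : B e' b = 0 := by simp [hb, hu1, H.ef2, hq]
  have hfb : B f' b = 0 := by simp [hb, hu1, H.ff2, h0]
  have g2 := eichE_good B hB L K hKL hint heven e' b H.ee2 heb H.he' hbK
  have e2 : ∃ c : ℚ, eichE B hB e' b H.ee2 heb (r + (2 : ℚ) • u1) = r + (2 : ℚ) • f' + c • e' := by
    refine ⟨- B b (r + (2 : ℚ) • u1) - B b b, ?_⟩
    change eich B e' b _ = _
    rw [eich_apply]
    have h2 : B e' (r + (2 : ℚ) • u1) = 2 := by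
      simp only [hu1, map_add, map_smul, smul_eq_mul, H.r3, hq, H.ef2]; ring
    rw [h2, hb]; module
  obtain ⟨c, e2⟩ := e2
  have hc : c = 0 := by
    have h3 := g2.1 (r + (2 : ℚ) • u1) (r + (2 : ℚ) • u1)
    rw [e2, ← hv1, ← e1, g1.1, hv] at h3
    simp only [map_add, map_smul, smul_eq_mul, LinearMap.add_apply, LinearMap.smul_apply,
      hr, H.r3, H.r4, hre, hrf, H.ff2, H.ee2, H.ef2, hfe'] at h3
    linarith
  have hfr : B f' (-r) = 0 := by simp [H.r4]
  have g3 := eichE_good B hB L K hKL hint heven f' (-r) H.ff2 hfr H.hf' (K.neg_mem hrK)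
  have e3 : eichE B hB f' (-r) H.ff2 hfr (r + (2 : ℚ) • f') = r := by
    change eich B f' (-r) _ = _
    rw [eich_apply]
    simp [H.r4, H.ff2, hr, hrf]
  refine ⟨_, (g1.trans g2).trans g3, ?_⟩
  simp only [LinearEquiv.trans_apply]
  rw [e1, hv1, e2, hc, zero_smul, add_zero, e3]

/-- Eichler criterion for unigonal vectors. -/
theorem eichler (B : V →ₗ[ℚ] V →ₗ[ℚ] ℚ) (hB : ∀ x y, B x y = B y x) (L K : AddSubgroup V)
    (hKL : K ≤ L)
    (hint : ∀ x ∈ K, ∀ y ∈ L, ∃ n : ℤ, B x y = n)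
    (heven : ∀ x ∈ K, ∃ n : ℤ, B x x = 2 * n)
    (r : V) (hrK : r ∈ K) (hr : B r r = -2) (n : ℕ) :
    ∀ (e f e' f' : V) (_ : HypPairs B K r e f e' f')
    (u : V) (_ : u ∈ K) (_ : B (r + (2 : ℚ) • u) (r + (2 : ℚ) • u) = -2)
    (m : ℤ) (_ : B f' u = m) (_ : m.natAbs = n),
    ∃ g, GoodIso B L K g ∧ g (r + (2 : ℚ) • u) = r := by
  induction n using Nat.strong_induction_on with
  | _ n ih =>
  intro e f e' f' H u hu hv m hm hmn
  rcases Nat.eq_zero_or_pos n with hn | hn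
  · have hm0 : m = 0 := by omega
    exact eichler_zero B hB L K hKL hint heven r e f e' f' H hrK hr u hu hv
      (by rw [hm, hm0]; simp)
  · obtain ⟨p, hp⟩ := hint f H.hf u (hKL hu)
    set t : ℤ := p / m with ht
    have hm0 : m ≠ 0 := by omega
    have hfe : B f e = 1 := by rw [hB, H.ef]
    have hfe' : B f' e = 0 := by rw [hB, H.x2]
    set a := (t : ℚ) • f' with ha
    have haK : a ∈ K := int_smul_mem K H.hf' _ t rfl
    have hea : B e a = 0 := by simp [ha, H.x2]
    have haa : B a a = 0 := by simp [ha, H.ff2]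
    have har : B a r = 0 := by simp [ha, H.r4]
    have g1 := eichE_good B hB L K hKL hint heven e a H.ee hea H.he haK
    have e1 : eichE B hB e a H.ee hea r = r := by
      change eich B e a r = r
      rw [eich_apply, H.r1, har]; simp
    set u1 := eichE B hB e a H.ee hea u with hu1
    have hu1' : u1 = u - B a u • e + B e u • a - B e u • ((B a a / 2) • e) := eich_apply ..
    have hu1K : u1 ∈ K := g1.2.2.2.1 u hu
    have e2 : eichE B hB e a H.ee hea (r + (2 : ℚ) • u) = r + (2 : ℚ) • u1 := by
      rw [map_add, map_smul, e1]
    have hv1 : B (r + (2 : ℚ) • u1) (r + (2 : ℚ) • u1) = -2 := by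
      rw [← e2, g1.1, hv]
    have hfu1 : B f u1 = ((p % m : ℤ) : ℚ) := by
      have h1 : p % m = p - m * t := by rw [ht]; have := Int.emod_add_mul_ediv p m; linarith
      rw [h1, hu1', haa]
      simp [ha, hp, hfe, hm, H.x4]; ring
    have hlt : (p % m).natAbs < n := by
      have h1 := Int.emod_nonneg p hm0
      have h2 := Int.emod_lt_abs p hm0
      have h3 := Int.natCast_natAbs m
      omega
    obtain ⟨g, hg, hgr⟩ := ih _ hlt e' f' e f (H.swap hB) u1 hu1K hv1 _ hfu1 rfl
    refine ⟨_, g1.trans hg, ?_⟩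
    rw [LinearEquiv.trans_apply, e2, hgr]

/-- Two orthogonal unigonal vectors can be moved to standard position. -/
theorem two_step (B : V →ₗ[ℚ] V →ₗ[ℚ] ℚ) (hB : ∀ x y, B x y = B y x) (L : AddSubgroup V)
    (hint : ∀ x ∈ L, ∀ y ∈ L, ∃ n : ℤ, B x y = n)
    (heven : ∀ x ∈ L, ∃ n : ℤ, B x x = 2 * n)
    (r r' e f e' f' : V) (hr : r ∈ L) (hr' : r' ∈ L) (hrr : B r r = -2) (hrr' : B r' r' = -2)
    (hro : B r r' = 0)
    (H : HypPairs B L r e f e' f') (H' : HypPairs B L r' e f e' f')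
    (hcl : ∀ v ∈ L, B v v = -2 → (∀ y ∈ L, ∃ n : ℤ, B v y = 2 * n) →
      (∃ u ∈ L, v = r + (2 : ℚ) • u) ∨ (∃ u ∈ L, v = r' + (2 : ℚ) • u))
    (w₁ w₂ : V) (h1 : ∃ u ∈ L, w₁ = r + (2 : ℚ) • u) (h2 : w₂ ∈ L)
    (s1 : B w₁ w₁ = -2) (s2 : B w₂ w₂ = -2)
    (d1 : ∀ y ∈ L, ∃ n : ℤ, B w₁ y = 2 * n) (d2 : ∀ y ∈ L, ∃ n : ℤ, B w₂ y = 2 * n)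
    (h12 : B w₁ w₂ = 0) :
    ∃ g : V ≃ₗ[ℚ] V, (∀ x y, B (g x) (g y) = B x y) ∧ (∀ x ∈ L, g x ∈ L) ∧
      (∀ x ∈ L, g.symm x ∈ L) ∧ g w₁ = r ∧ g w₂ = r' := by
  obtain ⟨u, hu, rfl⟩ := h1
  obtain ⟨m, hm⟩ := hint f' H.hf' u hu
  obtain ⟨g, hg, hgr⟩ := eichler B hB L L le_rfl hint heven r hr hrr _ e f e' f' H u hu s1 m hm rfl
  set v := g w₂ with hv
  have hvL : v ∈ L := hg.2.1 _ h2
  have hrv : B r v = 0 := by rw [← hgr, hv, hg.1, h12]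
  have hvv : B v v = -2 := by rw [hv, hg.1, s2]
  have dr : ∀ y ∈ L, ∃ n : ℤ, B r y = 2 * n := by
    intro y hy
    obtain ⟨n, hn⟩ := d1 (g.symm y) (hg.2.2.1 y hy)
    refine ⟨n, ?_⟩
    rw [← hn, ← hg.1 (r + (2 : ℚ) • u) (g.symm y), hgr, LinearEquiv.apply_symm_apply]
  have dv : ∀ y ∈ L, ∃ n : ℤ, B v y = 2 * n := by
    intro y hy
    obtain ⟨n, hn⟩ := d2 (g.symm y) (hg.2.2.1 y hy)
    refine ⟨n, ?_⟩
    rw [← hn, ← hg.1 w₂ (g.symm y), LinearEquiv.apply_symm_apply]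
  have hv2 : ∃ u ∈ L, v = r' + (2 : ℚ) • u := by
    rcases hcl v hvL hvv dv with ⟨u, hu, h⟩ | h
    · exfalso
      obtain ⟨n, hn⟩ := dr u hu
      rw [h] at hrv
      simp only [map_add, map_smul, smul_eq_mul, hn, hrr] at hrv
      have : (2 * n : ℚ) = 1 := by linarith
      have : 2 * n = 1 := by exact_mod_cast this
      omega
    · exact h
  obtain ⟨u', hu', hvu⟩ := hv2
  let K : AddSubgroup V := L ⊓ (LinearMap.ker (B r)).toAddSubgroup
  have memK : ∀ x, x ∈ K ↔ x ∈ L ∧ B r x = 0 := fun x => by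
    simp [K, AddSubgroup.mem_inf]
  have hKL : K ≤ L := fun x hx => ((memK x).1 hx).1
  have hr'K : r' ∈ K := (memK _).2 ⟨hr', hro⟩
  have hu'K : u' ∈ K := by
    refine (memK _).2 ⟨hu', ?_⟩
    rw [hvu] at hrv
    simpa [hro] using hrv
  have HK : HypPairs B K r' e f e' f' :=
    { H' with
      he := (memK _).2 ⟨H.he, by rw [hB, H.r1]⟩
      hf := (memK _).2 ⟨H.hf, by rw [hB, H.r2]⟩
      he' := (memK _).2 ⟨H.he', by rw [hB, H.r3]⟩
      hf' := (memK _).2 ⟨H.hf', by rw [hB, H.r4]⟩ }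
  obtain ⟨m', hm'⟩ := hint f' H.hf' u' hu'
  obtain ⟨g2, hg2, hgr2⟩ := eichler B hB L K hKL (fun x hx => hint x (hKL hx))
    (fun x hx => heven x (hKL hx)) r' hr'K hrr' _ e f e' f' HK u' hu'K (by rw [← hvu, hvv]) m' hm' rfl
  have hfix : g2 r = r := hg2.2.2.2.2 r (fun y hy => by rw [hB]; exact ((memK y).1 hy).2)
  refine ⟨g.trans g2, fun x y => ?_, fun x hx => ?_, fun x hx => ?_, ?_, ?_⟩
  · simp [hg.1, hg2.1]
  · exact hg2.2.1 _ (hg.2.1 _ hx)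
  · exact hg.2.2.1 _ (hg2.2.2.1 _ hx)
  · simp [hgr, hfix]
  · rw [LinearEquiv.trans_apply, ← hv, hvu, hgr2]

end Abstract
section Model

/-- Ambient space of `U² ⊕ E₈^k ⊕ D₂`. -/
abbrev WAmb (k : ℕ) := IIAmb k × (Fin 2 → ℚ)

/-- The form on `WAmb`. -/
def WForm (k : ℕ) (p q : WAmb k) : ℚ := IIForm k p.1 q.1 + negE p.2 q.2

/-- Intermediate lattices: the blocks in `S` have been converted to `E₈`. -/
def CSet (k : ℕ) (S : Finset (Fin k)) : Set (WAmb k) :=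
  {p | IntVec p.1.1 ∧ (∀ j ∈ S, p.1.2 j ∈ E8Set) ∧ (∀ j, j ∉ S → IntVec (p.1.2 j)) ∧
    IntVec p.2 ∧ ∃ a : ℤ, (∑ j, if j ∈ S then 0 else ∑ i, p.1.2 j i) + ∑ i, p.2 i = 2 * (a : ℚ)}

/-- the coordinate `b'` of the neighbour step -/
def nb (a b : ℚ) (x : Fin 8 → ℚ) : ℚ := 2 * a + 2 * b - ∑ i, x i

/-- The neighbour step, forward. -/
def stepFun (k : ℕ) (j : Fin k) (p : WAmb k) : WAmb k :=
  ((![nb (p.1.1 0) (p.1.1 1) (p.1.2 j) + p.1.2 j 7 - p.2 0,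
      nb (p.1.1 0) (p.1.1 1) (p.1.2 j), p.1.1 2, p.1.1 3],
    Function.update p.1.2 j (fun i => p.1.2 j i - p.1.1 0 / 2 +
      if i = 7 then nb (p.1.1 0) (p.1.1 1) (p.1.2 j) else 0)),
   ![p.2 0 - nb (p.1.1 0) (p.1.1 1) (p.1.2 j), p.2 1])

/-- The neighbour step, backward. -/
def stepInv (k : ℕ) (j : Fin k) (p : WAmb k) : WAmb k :=
  ((![2 * p.1.1 0 + 2 * p.1.1 1 + 2 * (p.2 0 - p.1.2 j 7),
      2 * p.1.1 0 + 2 * p.1.1 1 + 2 * (p.2 0 - p.1.2 j 7) + (∑ i, p.1.2 j i) / 2,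
      p.1.1 2, p.1.1 3],
    Function.update p.1.2 j (fun i => p.1.1 0 + p.1.1 1 + p.1.2 j i + (p.2 0 - p.1.2 j 7) -
      if i = 7 then p.1.1 1 else 0)),
   ![p.2 0 + p.1.1 1, p.2 1])

theorem step_left (k : ℕ) (j : Fin k) (p : WAmb k) : stepInv k j (stepFun k j p) = p := by
  refine Prod.ext (Prod.ext ?_ ?_) ?_
  · ext i
    fin_cases i <;> simp [stepInv, stepFun, nb, Fin.sum_univ_eight] <;> ring
  · ext l i
    by_cases h : l = j
    · subst h
      simp only [stepInv, stepFun, nb, Function.update_self]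
      by_cases hi : i = 7 <;> simp [hi, Fin.sum_univ_eight] <;> ring
    · simp [stepInv, stepFun, Function.update_of_ne h]
  · ext i
    fin_cases i <;> simp [stepInv, stepFun]

theorem step_right (k : ℕ) (j : Fin k) (p : WAmb k) : stepFun k j (stepInv k j p) = p := by
  refine Prod.ext (Prod.ext ?_ ?_) ?_
  · ext i
    fin_cases i <;> simp [stepInv, stepFun, nb, Fin.sum_univ_eight] <;> ring
  · ext l i
    by_cases h : l = j
    · subst h
      simp only [stepInv, stepFun, nb, Function.update_self]
      by_cases hi : i = 7 <;> simp [hi, Fin.sum_univ_eight] <;> ring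
    · simp [stepInv, stepFun, Function.update_of_ne h]
  · ext i
    fin_cases i <;> simp [stepInv, stepFun, nb, Fin.sum_univ_eight]; ring

/-- The neighbour step as a linear equivalence. -/
def stepE (k : ℕ) (j : Fin k) : WAmb k ≃ₗ[ℚ] WAmb k where
  toFun := stepFun k j
  invFun := stepInv k j
  left_inv := step_left k j
  right_inv := step_right k j
  map_add' p q := by
    refine Prod.ext (Prod.ext ?_ ?_) ?_
    · ext i
      fin_cases i <;> simp [stepFun, nb, Fin.sum_univ_eight] <;> ring
    · ext l i
      by_cases h : l = j
      · subst h
        by_cases hi : i = 7 <;> simp [stepFun, nb, hi, Fin.sum_univ_eight] <;> ring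
      · simp [stepFun, Function.update_of_ne h]
    · ext i
      fin_cases i <;> simp [stepFun, nb, Fin.sum_univ_eight]; ring
  map_smul' c p := by
    refine Prod.ext (Prod.ext ?_ ?_) ?_
    · ext i
      fin_cases i <;> simp [stepFun, nb, Fin.sum_univ_eight] <;> ring
    · ext l i
      by_cases h : l = j
      · subst h
        by_cases hi : i = 7 <;> simp [stepFun, nb, hi, Fin.sum_univ_eight] <;> ring
      · simp [stepFun, Function.update_of_ne h]
    · ext i
      fin_cases i <;> simp [stepFun, nb, Fin.sum_univ_eight]; ring

theorem step_form (k : ℕ) (j : Fin k) (p q : WAmb k) :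
    WForm k (stepFun k j p) (stepFun k j q) = WForm k p q := by
  have h : ∀ l ∈ Finset.univ.erase j, negE ((stepFun k j p).1.2 l) ((stepFun k j q).1.2 l) =
      negE (p.1.2 l) (q.1.2 l) := by
    intro l hl
    simp [stepFun, Function.update_of_ne (Finset.ne_of_mem_erase hl)]
  unfold WForm IIForm
  rw [← Finset.add_sum_erase _ _ (Finset.mem_univ j), Finset.sum_congr rfl h,
    ← Finset.add_sum_erase _ (fun l => negE (p.1.2 l) (q.1.2 l)) (Finset.mem_univ j)]
  simp [stepFun, nb, negE, UForm, Fin.sum_univ_eight, Fin.sum_univ_two]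
  ring

theorem blocksum (k : ℕ) (S : Finset (Fin k)) (j : Fin k) (hj : j ∉ S) (x : Fin k → Fin 8 → ℚ)
    (y : Fin 8 → ℚ) :
    (∑ l, if l ∈ S then 0 else ∑ i, x l i) =
      (∑ l, if l ∈ insert j S then 0 else ∑ i, Function.update x j y l i) + ∑ i, x j i := by
  rw [← Finset.add_sum_erase _ _ (Finset.mem_univ j),
    ← Finset.add_sum_erase _ (fun l => if l ∈ insert j S then 0 else
      ∑ i, Function.update x j y l i) (Finset.mem_univ j)]
  simp only [hj, if_false, Finset.mem_insert_self, if_true, zero_add]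
  rw [add_comm]
  congr 1
  refine Finset.sum_congr rfl fun l hl => ?_
  have h := Finset.ne_of_mem_erase hl
  simp [h]

theorem step_mem (k : ℕ) (S : Finset (Fin k)) (j : Fin k) (hj : j ∉ S) (p : WAmb k)
    (hp : p ∈ CSet k S) : stepFun k j p ∈ CSet k (insert j S) := by
  obtain ⟨h1, h2, h3, h4, n, h5⟩ := hp
  have hx := h3 j hj
  choose u hu using h1
  choose x hx using hx
  choose y hy using h4
  have hb : nb (p.1.1 0) (p.1.1 1) (p.1.2 j) = ((2 * u 0 + 2 * u 1 - ∑ i, x i : ℤ) : ℚ) := by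
    simp [nb, hu, hx]
  set b : ℤ := 2 * u 0 + 2 * u 1 - ∑ i, x i with hbd
  refine ⟨?_, ?_, ?_, ?_, ?_⟩
  · intro i
    fin_cases i
    · exact ⟨b + x 7 - y 0, by simp [stepFun, hb, hx, hy]⟩
    · exact ⟨b, by simp [stepFun, hb]⟩
    · exact ⟨u 2, by simp [stepFun, hu]⟩
    · exact ⟨u 3, by simp [stepFun, hu]⟩
  · intro l hl
    by_cases h : l = j
    · subst h
      refine ⟨?_, ?_⟩
      · rcases Int.even_or_odd' (u 0) with ⟨c, hc | hc⟩
        · left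
          intro i
          refine ⟨x i - c + if i = 7 then b else 0, ?_⟩
          simp only [stepFun, Function.update_self, hb]
          simp only [hu, hx, hc]
          split_ifs <;> push_cast <;> ring
        · right
          intro i
          refine ⟨x i - c - 1 + if i = 7 then b else 0, ?_⟩
          simp only [stepFun, Function.update_self, hb, Pi.sub_apply, halfVec]
          simp only [hu, hx, hc]
          split_ifs <;> push_cast <;> ring
      · refine ⟨u 1 - u 0, ?_⟩
        simp only [stepFun, Function.update_self, hb]
        simp only [hu, hx]
        simp [hbd, Fin.sum_univ_eight]
        ring
    · have : l ∈ S := (Finset.mem_insert.1 hl).resolve_left h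
      simpa [stepFun, Function.update_of_ne h] using h2 l this
  · intro l hl
    have h : l ≠ j := fun h => hl (h ▸ Finset.mem_insert_self _ _)
    have h' : l ∉ S := fun h => hl (Finset.mem_insert_of_mem h)
    simpa [stepFun, Function.update_of_ne h] using h3 l h'
  · intro i
    fin_cases i
    · exact ⟨y 0 - b, by simp [stepFun, hb, hy]⟩
    · exact ⟨y 1, by simp [stepFun, hy]⟩
  · refine ⟨n - u 0 - u 1, ?_⟩
    rw [blocksum k S j hj _ ((stepFun k j p).1.2 j)] at h5
    have e : Function.update p.1.2 j ((stepFun k j p).1.2 j) = (stepFun k j p).1.2 := by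
      simp [stepFun]
    rw [e] at h5
    have h6 : ∑ i, (stepFun k j p).2 i = ∑ i, p.2 i - b := by
      simp [stepFun, hb, Fin.sum_univ_two]; ring
    rw [h6]
    have h7 : ∑ i, p.1.2 j i = ((∑ i, x i : ℤ) : ℚ) := by simp [hx]
    rw [h7] at h5
    push_cast [hbd] at h5 ⊢
    linarith

theorem stepInv_mem (k : ℕ) (S : Finset (Fin k)) (j : Fin k) (hj : j ∉ S) (p : WAmb k)
    (hp : p ∈ CSet k (insert j S)) : stepInv k j p ∈ CSet k S := by
  obtain ⟨h1, h2, h3, h4, n, h5⟩ := hp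
  obtain ⟨hx, s, hs⟩ := h2 j (Finset.mem_insert_self _ _)
  choose u hu using h1
  choose y hy using h4
  have hx7 : ∃ c : ℤ, 2 * p.1.2 j 7 = c := by
    rcases hx with hx | hx
    · obtain ⟨c, hc⟩ := hx 7
      exact ⟨2 * c, by rw [hc]; push_cast; ring⟩
    · obtain ⟨c, hc⟩ := hx 7
      refine ⟨2 * c + 1, ?_⟩
      simp only [Pi.sub_apply, halfVec] at hc
      push_cast; linarith
  have hxd : ∀ i, ∃ c : ℤ, p.1.2 j i - p.1.2 j 7 = c := by
    intro i
    rcases hx with hx | hx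
    · obtain ⟨c, hc⟩ := hx 7
      obtain ⟨d, hd⟩ := hx i
      exact ⟨d - c, by rw [hc, hd]; push_cast; ring⟩
    · obtain ⟨c, hc⟩ := hx 7
      obtain ⟨d, hd⟩ := hx i
      refine ⟨d - c, ?_⟩
      simp only [Pi.sub_apply, halfVec] at hc hd
      push_cast; linarith
  obtain ⟨c, hc⟩ := hx7
  choose d hd using hxd
  refine ⟨?_, ?_, ?_, ?_, ?_⟩
  · intro i
    fin_cases i
    · exact ⟨2 * u 0 + 2 * u 1 + 2 * y 0 - c, by simp [stepInv, hu, hy, ← hc]; ring⟩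
    · exact ⟨2 * u 0 + 2 * u 1 + 2 * y 0 - c + s, by simp [stepInv, hu, hy, ← hc, hs]; ring⟩
    · exact ⟨u 2, by simp [stepInv, hu]⟩
    · exact ⟨u 3, by simp [stepInv, hu]⟩
  · intro l hl
    have h : l ≠ j := fun h => hj (h ▸ hl)
    simpa [stepInv, Function.update_of_ne h] using h2 l (Finset.mem_insert_of_mem hl)
  · intro l hl
    by_cases h : l = j
    · subst h
      intro i
      refine ⟨u 0 + u 1 + d i + y 0 - if i = 7 then u 1 else 0, ?_⟩
      simp only [stepInv, Function.update_self, hu, hy]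
      push_cast
      rw [← hd]
      split_ifs <;> ring
    · simpa [stepInv, Function.update_of_ne h] using h3 l (by simp [h, hl])
  · intro i
    fin_cases i
    · exact ⟨y 0 + u 1, by simp [stepInv, hu, hy]⟩
    · exact ⟨y 1, by simp [stepInv, hy]⟩
  · refine ⟨n + 4 * u 0 + 4 * u 1 + s + 4 * y 0 - 2 * c, ?_⟩
    rw [blocksum k S j hj _ (p.1.2 j)]
    have e : Function.update (stepInv k j p).1.2 j (p.1.2 j) = p.1.2 := by
      simp [stepInv]
    rw [e]
    have h6 : ∑ i, (stepInv k j p).2 i = ∑ i, p.2 i + u 1 := by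
      simp [stepInv, hu, Fin.sum_univ_two]; ring
    have h7 : ∑ i, (stepInv k j p).1.2 j i = 8 * u 0 + 7 * u 1 + 2 * s + 8 * y 0 - 4 * c := by
      rw [← hs, ← hc]
      simp [stepInv, hu, hy, Fin.sum_univ_eight]; ring
    rw [h6, h7]
    push_cast
    linarith

theorem exists_psi (k : ℕ) (S : Finset (Fin k)) : ∃ ψ : WAmb k ≃ₗ[ℚ] WAmb k,
    (∀ p q, WForm k (ψ p) (ψ q) = WForm k p q) ∧ ∀ p, p ∈ CSet k ∅ ↔ ψ p ∈ CSet k S := by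
  induction S using Finset.induction_on with
  | empty => exact ⟨LinearEquiv.refl _ _, by simp, by simp⟩
  | insert j S hj ih =>
    obtain ⟨ψ, h1, h2⟩ := ih
    refine ⟨ψ.trans (stepE k j), fun p q => ?_, fun p => ?_⟩
    · rw [← h1 p q]
      exact step_form k j _ _
    · rw [h2]
      refine ⟨fun h => step_mem k S j hj _ h, fun h => ?_⟩
      have := stepInv_mem k S j hj _ h
      have e : stepInv k j ((ψ.trans (stepE k j)) p) = ψ p := step_left k j _
      rwa [e] at this

/-- Index bijection. -/
def idx (k : ℕ) : Fin 4 ⊕ ((Fin k × Fin 8) ⊕ Fin 2) ≃ Fin (8 * k + 4 + 2) :=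
  ((Equiv.sumCongr (Equiv.refl (Fin 4))
    ((Equiv.sumCongr finProdFinEquiv (Equiv.refl (Fin 2))).trans finSumFinEquiv)).trans
      finSumFinEquiv).trans (finCongr (by ring))

theorem idx_inl (k : ℕ) (i : Fin 4) : ((idx k (Sum.inl i)) : ℕ) = i := by
  simp [idx]

theorem idx_inr (k : ℕ) (z) : 4 ≤ ((idx k (Sum.inr z)) : ℕ) := by
  simp [idx]

/-- Reindexing equivalence. -/
def reE (k : ℕ) : WAmb k ≃ₗ[ℚ] (Fin (8 * k + 4 + 2) → ℚ) where
  toFun p := fun i => Sum.elim p.1.1 (Sum.elim (fun z => p.1.2 z.1 z.2) p.2) ((idx k).symm i)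
  invFun x := ((fun i => x (idx k (Sum.inl i)), fun j i => x (idx k (Sum.inr (Sum.inl (j, i))))),
    fun i => x (idx k (Sum.inr (Sum.inr i))))
  left_inv p := by simp
  right_inv x := by
    ext i
    obtain ⟨z, rfl⟩ := (idx k).surjective i
    rcases z with z | z | z <;> simp
  map_add' p q := by
    ext i
    obtain ⟨z, rfl⟩ := (idx k).surjective i
    rcases z with z | z | z <;> simp
  map_smul' c p := by
    ext i
    obtain ⟨z, rfl⟩ := (idx k).surjective i
    rcases z with z | z | z <;> simp

theorem reE_idx (k : ℕ) (p : WAmb k) (z) :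
    reE k p (idx k z) = Sum.elim p.1.1 (Sum.elim (fun z => p.1.2 z.1 z.2) p.2) z := by
  simp [reE]

theorem sum_idx (k : ℕ) (F : Fin (8 * k + 4 + 2) → ℚ) :
    (∑ i : Fin (8 * k + 4 + 2), if 4 ≤ (i : ℕ) then F i else 0) =
      (∑ j, ∑ i, F (idx k (Sum.inr (Sum.inl (j, i))))) + ∑ i, F (idx k (Sum.inr (Sum.inr i))) := by
  rw [← (idx k).sum_comp, Fintype.sum_sum_type, Fintype.sum_sum_type, Fintype.sum_prod_type]
  simp only [idx_inr, if_true]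
  have : ∀ i : Fin 4, ¬ (4 ≤ ((idx k (Sum.inl i)) : ℕ)) := by
    intro i; rw [idx_inl]; omega
  simp [this]

theorem fin_val2 (N : ℕ) (hN : 4 ≤ N) : ((2 : Fin (N + 2)) : ℕ) = 2 := by
  change 2 % (N + 2) = 2
  exact Nat.mod_eq_of_lt (by omega)

theorem fin_val3 (N : ℕ) (hN : 4 ≤ N) : ((3 : Fin (N + 2)) : ℕ) = 3 := by
  change 3 % (N + 2) = 3
  exact Nat.mod_eq_of_lt (by omega)

theorem reE_form (k : ℕ) (p q : WAmb k) : LamForm (8 * k + 4) (reE k p) (reE k q) = WForm k p q := by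
  unfold LamForm
  rw [sum_idx k (fun i => reE k p i * reE k q i)]
  have e0 : (0 : Fin (8 * k + 4 + 2)) = idx k (Sum.inl 0) := Fin.ext (by rw [idx_inl]; rfl)
  have e1 : (1 : Fin (8 * k + 4 + 2)) = idx k (Sum.inl 1) := Fin.ext (by rw [idx_inl]; simp)
  have e2 : (2 : Fin (8 * k + 4 + 2)) = idx k (Sum.inl 2) := Fin.ext (by
    rw [idx_inl, fin_val2 _ (by omega)]; rfl)
  have e3 : (3 : Fin (8 * k + 4 + 2)) = idx k (Sum.inl 3) := Fin.ext (by
    rw [idx_inl, fin_val3 _ (by omega)]; rfl)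
  rw [e0, e1, e2, e3]
  simp only [reE_idx, Sum.elim_inl, Sum.elim_inr, WForm, IIForm, UForm, negE,
    Finset.sum_neg_distrib]
  ring

theorem reE_mem (k : ℕ) (p : WAmb k) : reE k p ∈ LamSet (8 * k + 4) ↔ p ∈ CSet k ∅ := by
  unfold LamSet CSet
  simp only [Set.mem_ofPred_eq, sum_idx k (reE k p), reE_idx, Sum.elim_inl, Sum.elim_inr,
    Finset.notMem_empty, if_false, not_false_eq_true, false_imp_iff, implies_true, true_and,
    forall_true_left]
  have : IntVec (reE k p) ↔ IntVec p.1.1 ∧ (∀ j, IntVec (p.1.2 j)) ∧ IntVec p.2 := by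
    unfold IntVec
    rw [← (idx k).forall_congr_right]
    simp only [reE_idx, Sum.forall, Sum.elim_inl, Sum.elim_inr, Prod.forall]
  rw [this]
  tauto

theorem exists_Phi (k : ℕ) : ∃ Φ : WAmb k ≃ₗ[ℚ] (Fin (8 * k + 4 + 2) → ℚ),
    (∀ p q, LamForm (8 * k + 4) (Φ p) (Φ q) = WForm k p q) ∧
    ∀ p, Φ p ∈ LamSet (8 * k + 4) ↔
      (p.1 ∈ IISet k ∧ IntVec p.2 ∧ ∃ a : ℤ, ∑ i, p.2 i = 2 * (a : ℚ)) := by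
  obtain ⟨ψ, h1, h2⟩ := exists_psi k Finset.univ
  refine ⟨ψ.symm.trans (reE k), fun p q => ?_, fun p => ?_⟩
  · rw [LinearEquiv.trans_apply, LinearEquiv.trans_apply, reE_form, ← h1]; simp
  · rw [LinearEquiv.trans_apply, reE_mem, h2]
    simp [CSet, IISet, and_assoc]

end Model
section Lattice

theorem LamForm_symm (N : ℕ) (x y : Fin (N + 2) → ℚ) : LamForm N x y = LamForm N y x := by
  unfold LamForm
  have : ∀ i, x i * y i = y i * x i := fun i => mul_comm _ _
  simp only [this]
  ring

theorem LamForm_add_left (N : ℕ) (x x' y : Fin (N + 2) → ℚ) :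
    LamForm N (x + x') y = LamForm N x y + LamForm N x' y := by
  unfold LamForm
  have : ∀ i : Fin (N + 2), (if 4 ≤ (i : ℕ) then (x + x') i * y i else 0) =
      (if 4 ≤ (i : ℕ) then x i * y i else 0) + (if 4 ≤ (i : ℕ) then x' i * y i else 0) := by
    intro i
    split_ifs
    · simp [add_mul]
    · simp
  rw [Finset.sum_congr rfl (fun i _ => this i), Finset.sum_add_distrib]
  simp only [Pi.add_apply]
  ring

theorem LamForm_smul_left (N : ℕ) (c : ℚ) (x y : Fin (N + 2) → ℚ) :
    LamForm N (c • x) y = c * LamForm N x y := by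
  unfold LamForm
  have : ∀ i : Fin (N + 2), (if 4 ≤ (i : ℕ) then (c • x) i * y i else 0) =
      c * (if 4 ≤ (i : ℕ) then x i * y i else 0) := by
    intro i
    split_ifs
    · simp [mul_assoc]
    · simp
  rw [Finset.sum_congr rfl (fun i _ => this i), ← Finset.mul_sum]
  simp only [Pi.smul_apply, smul_eq_mul]
  ring

/-- The form of `Λ_N` as a bilinear map. -/
def LB (N : ℕ) : (Fin (N + 2) → ℚ) →ₗ[ℚ] (Fin (N + 2) → ℚ) →ₗ[ℚ] ℚ :=
  LinearMap.mk₂ ℚ (LamForm N) (LamForm_add_left N) (LamForm_smul_left N)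
    (fun x y z => by
      rw [LamForm_symm, LamForm_add_left, LamForm_symm N y x, LamForm_symm N z x])
    (fun c x y => by
      rw [LamForm_symm, LamForm_smul_left, LamForm_symm N y x]; rfl)

theorem LB_apply (N : ℕ) (x y : Fin (N + 2) → ℚ) : LB N x y = LamForm N x y := rfl

/-- `Λ_N` as an additive subgroup. -/
def LamSub (N : ℕ) : AddSubgroup (Fin (N + 2) → ℚ) where
  carrier := LamSet N
  add_mem' := by
    rintro x y ⟨hx, a, ha⟩ ⟨hy, b, hb⟩
    refine ⟨fun i => ?_, a + b, ?_⟩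
    · obtain ⟨c, hc⟩ := hx i
      obtain ⟨d, hd⟩ := hy i
      exact ⟨c + d, by simp [hc, hd]⟩
    · push_cast
      rw [mul_add, ← ha, ← hb, ← Finset.sum_add_distrib]
      refine Finset.sum_congr rfl fun i _ => ?_
      split_ifs <;> simp
  zero_mem' := ⟨fun i => ⟨0, by simp⟩, 0, by simp⟩
  neg_mem' := by
    rintro x ⟨hx, a, ha⟩
    refine ⟨fun i => ?_, -a, ?_⟩
    · obtain ⟨c, hc⟩ := hx i
      exact ⟨-c, by simp [hc]⟩
    · push_cast
      rw [mul_neg, ← ha, ← Finset.sum_neg_distrib]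
      refine Finset.sum_congr rfl fun i _ => ?_
      split_ifs <;> simp

theorem mem_LamSub (N : ℕ) (x) : x ∈ LamSub N ↔ x ∈ LamSet N := Iff.rfl

theorem Lam_int (N : ℕ) (x y : Fin (N + 2) → ℚ) (hx : IntVec x) (hy : IntVec y) :
    ∃ n : ℤ, LamForm N x y = n := by
  choose a ha using hx
  choose b hb using hy
  refine ⟨a 0 * b 1 + a 1 * b 0 + a 2 * b 3 + a 3 * b 2 -
    ∑ i : Fin (N + 2), (if 4 ≤ (i : ℕ) then a i * b i else 0), ?_⟩
  unfold LamForm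
  simp only [ha, hb]
  push_cast
  rfl

theorem Lam_even (N : ℕ) (x : Fin (N + 2) → ℚ) (hx : x ∈ LamSet N) :
    ∃ n : ℤ, LamForm N x x = 2 * n := by
  obtain ⟨hx, s, hs⟩ := hx
  choose a ha using hx
  have h1 : (∑ i : Fin (N + 2), if 4 ≤ (i : ℕ) then a i else 0) = 2 * s := by
    simp only [ha] at hs
    exact_mod_cast hs
  have h2 : (2 : ℤ) ∣ ∑ i : Fin (N + 2), ((if 4 ≤ (i : ℕ) then a i * a i else 0) -
      (if 4 ≤ (i : ℕ) then a i else 0)) := by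
    refine Finset.dvd_sum fun i _ => ?_
    split_ifs
    · have := (Int.even_mul_pred_self (a i)).two_dvd
      rwa [mul_sub, mul_one] at this
    · simp
  rw [Finset.sum_sub_distrib, h1] at h2
  obtain ⟨t, ht⟩ := h2
  refine ⟨a 0 * a 1 + a 2 * a 3 - t - s, ?_⟩
  have h3 : (∑ i : Fin (N + 2), if 4 ≤ (i : ℕ) then a i * a i else 0) = 2 * t + 2 * s := by
    linarith
  have h4 : (∑ i : Fin (N + 2), if 4 ≤ (i : ℕ) then (a i : ℚ) * a i else 0) = 2 * t + 2 * s := by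
    exact_mod_cast h3
  unfold LamForm
  simp only [ha, h4]
  push_cast
  ring

/-- test vector supported on a hyperbolic coordinate -/
theorem testU_mem (N c : ℕ) (hc : c < 4) :
    (fun l : Fin (N + 2) => if (l : ℕ) = c then (1 : ℚ) else 0) ∈ LamSet N := by
  refine ⟨fun i => ⟨if (i : ℕ) = c then 1 else 0, by push_cast; rfl⟩, 0, ?_⟩
  simp only [Int.cast_zero, mul_zero]
  refine Finset.sum_eq_zero fun i _ => ?_
  split_ifs <;> first | rfl | omega

theorem testU_form (N c : ℕ) (hN : 4 ≤ N) (hc : c < 4) (v : Fin (N + 2) → ℚ) :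
    LamForm N v (fun l : Fin (N + 2) => if (l : ℕ) = c then (1 : ℚ) else 0) =
      if c = 0 then v 1 else if c = 1 then v 0 else if c = 2 then v 3 else v 2 := by
  unfold LamForm
  have h : (∑ i : Fin (N + 2), if 4 ≤ (i : ℕ) then v i * (if (i : ℕ) = c then (1 : ℚ) else 0)
      else 0) = 0 := by
    refine Finset.sum_eq_zero fun i _ => ?_
    split_ifs <;> first | omega | simp
  rw [h]
  simp only [fin_val2 N hN, fin_val3 N hN]
  interval_cases c <;> simp

theorem testD_mem (N : ℕ) (i j : Fin (N + 2)) (hi : 4 ≤ (i : ℕ)) (hj : 4 ≤ (j : ℕ)) :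
    (fun l : Fin (N + 2) => (if l = i then (1 : ℚ) else 0) + if l = j then 1 else 0) ∈
      LamSet N := by
  refine ⟨fun l => ⟨(if l = i then 1 else 0) + if l = j then 1 else 0, by push_cast; rfl⟩, 1, ?_⟩
  have : ∀ l : Fin (N + 2), (if 4 ≤ (l : ℕ) then
      ((if l = i then (1 : ℚ) else 0) + if l = j then 1 else 0) else 0) =
      (if l = i then (1 : ℚ) else 0) + if l = j then 1 else 0 := by
    intro l
    by_cases h : 4 ≤ (l : ℕ)
    · simp [h]
    · have h1 : l ≠ i := fun e => h (e ▸ hi)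
      have h2 : l ≠ j := fun e => h (e ▸ hj)
      simp [h, h1, h2]
  simp only [this, Finset.sum_add_distrib]
  simp
  norm_num

theorem testD_form (N : ℕ) (hN : 4 ≤ N) (i j : Fin (N + 2)) (hi : 4 ≤ (i : ℕ)) (hj : 4 ≤ (j : ℕ))
    (v : Fin (N + 2) → ℚ) :
    LamForm N v (fun l : Fin (N + 2) => (if l = i then (1 : ℚ) else 0) + if l = j then 1 else 0) =
      - (v i + v j) := by
  unfold LamForm
  have : ∀ l : Fin (N + 2), (if 4 ≤ (l : ℕ) then
      v l * ((if l = i then (1 : ℚ) else 0) + if l = j then 1 else 0) else 0) =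
      (if l = i then v i else 0) + if l = j then v j else 0 := by
    intro l
    by_cases h : 4 ≤ (l : ℕ)
    · simp only [h, if_true]
      split_ifs with h1 h2 h2
      · subst h1; subst h2; ring
      · subst h1; ring
      · subst h2; ring
      · ring
    · have h1 : l ≠ i := fun e => h (e ▸ hi)
      have h2 : l ≠ j := fun e => h (e ▸ hj)
      simp [h, h1, h2]
  have ne : ∀ m l : Fin (N + 2), (m : ℕ) < 4 → 4 ≤ (l : ℕ) → m ≠ l := by
    intro m l h1 h2 e
    subst e
    omega
  have z0 : ((0 : Fin (N + 2)) : ℕ) < 4 := by simp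
  have z1 : ((1 : Fin (N + 2)) : ℕ) < 4 := by simp
  have z2 : ((2 : Fin (N + 2)) : ℕ) < 4 := by rw [fin_val2 N hN]; norm_num
  have z3 : ((3 : Fin (N + 2)) : ℕ) < 4 := by rw [fin_val3 N hN]; norm_num
  simp only [this, Finset.sum_add_distrib, ne _ _ z0 hi, ne _ _ z1 hi, ne _ _ z2 hi, ne _ _ z3 hi,
    ne _ _ z0 hj, ne _ _ z1 hj, ne _ _ z2 hj, ne _ _ z3 hj]
  simp

/-- Coordinates of unigonal vectors. -/
theorem unigonal_coords (N : ℕ) (hN : 4 ≤ N) (v : Fin (N + 2) → ℚ) (hv : v ∈ LamSet N)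
    (hs : LamForm N v v = -2) (hd : ∀ y ∈ LamSet N, ∃ n : ℤ, LamForm N v y = 2 * n)
    (i : Fin (N + 2)) : ∃ n : ℤ, v i = 2 * n + if 4 ≤ (i : ℕ) then 1 else 0 := by
  have hlow : ∀ i : Fin (N + 2), (i : ℕ) < 4 → ∃ n : ℤ, v i = 2 * n := by
    intro i hi
    have e0 := hd _ (testU_mem N 0 (by norm_num))
    have e1 := hd _ (testU_mem N 1 (by norm_num))
    have e2 := hd _ (testU_mem N 2 (by norm_num))
    have e3 := hd _ (testU_mem N 3 (by norm_num))
    rw [testU_form N _ hN (by norm_num)] at e0 e1 e2 e3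
    simp only [OfNat.ofNat_ne_zero, if_true, if_false, one_ne_zero, OfNat.ofNat_ne_one] at e0 e1 e2 e3
    norm_num at e3
    have hc : (i : ℕ) = 0 ∨ (i : ℕ) = 1 ∨ (i : ℕ) = 2 ∨ (i : ℕ) = 3 := by omega
    rcases hc with h | h | h | h
    · rwa [show i = 0 from Fin.ext (by simpa using h)]
    · rwa [show i = 1 from Fin.ext (by simpa using h)]
    · rwa [show i = 2 from Fin.ext (by rw [fin_val2 N hN, h])]
    · rwa [show i = 3 from Fin.ext (by rw [fin_val3 N hN, h])]
  by_cases hi : 4 ≤ (i : ℕ)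
  · simp only [hi, if_true]
    obtain ⟨c, hc⟩ := hv.1 i
    rcases Int.even_or_odd' c with ⟨m, hm | hm⟩
    · exfalso
      have hall : IntVec ((1 / 2 : ℚ) • v) := by
        intro j
        by_cases hj : 4 ≤ (j : ℕ)
        · obtain ⟨n, hn⟩ := hd _ (testD_mem N i j hi hj)
          rw [testD_form N hN i j hi hj, hc, hm] at hn
          refine ⟨-n - m, ?_⟩
          simp only [Pi.smul_apply, smul_eq_mul]
          push_cast at hn ⊢
          linarith
        · obtain ⟨n, hn⟩ := hlow j (by omega)
          exact ⟨n, by simp [hn]⟩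
      obtain ⟨n, hn⟩ := Lam_int N _ _ hall hall
      rw [LamForm_smul_left, LamForm_symm, LamForm_smul_left, hs] at hn
      have h2 : (2 * n : ℚ) = -1 := by linarith
      have h3 : 2 * n = -1 := by exact_mod_cast h2
      omega
    · exact ⟨m, by rw [hc, hm]; push_cast; ring⟩
  · obtain ⟨n, hn⟩ := hlow i (by omega)
    exact ⟨n, by simp [hi, hn]⟩

theorem half_diff_not_mem (N : ℕ) (r r' : Fin (N + 2) → ℚ) (h1 : LamForm N r r = -2)
    (h2 : LamForm N r' r' = -2) (h3 : LamForm N r r' = 0) :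
    (1 / 2 : ℚ) • r - (1 / 2 : ℚ) • r' ∉ LamSet N := by
  intro h
  obtain ⟨n, hn⟩ := Lam_even N _ h
  have h3' : LamForm N r' r = 0 := by rw [LamForm_symm, h3]
  simp only [← LB_apply] at h1 h2 h3 h3' hn
  simp only [map_sub, map_smul, LinearMap.sub_apply, LinearMap.smul_apply, smul_eq_mul,
    h1, h2, h3, h3'] at hn
  have h4 : (2 * n : ℚ) = -1 := by linarith
  have h5 : 2 * n = -1 := by exact_mod_cast h4
  omega

/-- The two classes of unigonal vectors. -/
theorem unigonal_class (N : ℕ) (hN : 4 ≤ N) (v r r' : Fin (N + 2) → ℚ)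
    (hv : v ∈ LamSet N) (hr : r ∈ LamSet N) (hr' : r' ∈ LamSet N)
    (sv : LamForm N v v = -2) (sr : LamForm N r r = -2) (sr' : LamForm N r' r' = -2)
    (dv : ∀ y ∈ LamSet N, ∃ n : ℤ, LamForm N v y = 2 * n)
    (dr : ∀ y ∈ LamSet N, ∃ n : ℤ, LamForm N r y = 2 * n)
    (dr' : ∀ y ∈ LamSet N, ∃ n : ℤ, LamForm N r' y = 2 * n)
    (ho : LamForm N r r' = 0) :
    (∃ u ∈ LamSub N, v = r + (2 : ℚ) • u) ∨ (∃ u ∈ LamSub N, v = r' + (2 : ℚ) • u) := by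
  choose a ha using unigonal_coords N hN v hv sv dv
  choose b hb using unigonal_coords N hN r hr sr dr
  choose c hc using unigonal_coords N hN r' hr' sr' dr'
  have key : ∀ (x y : Fin (N + 2) → ℚ) (a b : Fin (N + 2) → ℤ)
      (_ : ∀ i, x i = 2 * (a i : ℚ) + if 4 ≤ (i : ℕ) then 1 else 0)
      (_ : ∀ i, y i = 2 * (b i : ℚ) + if 4 ≤ (i : ℕ) then 1 else 0)
      (s : ℤ) (_ : (∑ i : Fin (N + 2), if 4 ≤ (i : ℕ) then a i else 0) -
        (∑ i : Fin (N + 2), if 4 ≤ (i : ℕ) then b i else 0) = 2 * s),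
      (1 / 2 : ℚ) • x - (1 / 2 : ℚ) • y ∈ LamSet N := by
    intro x y a b ha hb s hs
    have hxy : ∀ i, ((1 / 2 : ℚ) • x - (1 / 2 : ℚ) • y) i = ((a i - b i : ℤ) : ℚ) := by
      intro i
      simp only [Pi.sub_apply, Pi.smul_apply, smul_eq_mul, ha, hb]
      push_cast; ring
    refine ⟨fun i => ⟨_, hxy i⟩, s, ?_⟩
    simp only [hxy]
    rw [← Finset.sum_sub_distrib] at hs
    have : (∑ i : Fin (N + 2), if 4 ≤ (i : ℕ) then a i - b i else 0) = 2 * s := by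
      rw [← hs]
      refine Finset.sum_congr rfl fun i _ => ?_
      split_ifs <;> simp
    exact_mod_cast this
  have hne := half_diff_not_mem N r r' sr sr' ho
  set A := (∑ i : Fin (N + 2), if 4 ≤ (i : ℕ) then a i else 0) with hA
  set B := (∑ i : Fin (N + 2), if 4 ≤ (i : ℕ) then b i else 0) with hB
  set C := (∑ i : Fin (N + 2), if 4 ≤ (i : ℕ) then c i else 0) with hC
  have hodd : ¬ ∃ s, B - C = 2 * s := by
    rintro ⟨s, hs⟩
    exact hne (key r r' b c hb hc s hs)
  by_cases h : ∃ s, A - B = 2 * s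
  · obtain ⟨s, hs⟩ := h
    exact Or.inl ⟨_, key v r a b ha hb s hs, by module⟩
  · have : ∃ s, A - C = 2 * s := by
      refine ⟨(A - C) / 2, ?_⟩
      have h1 : (B - C) % 2 ≠ 0 := fun e => hodd ⟨(B - C) / 2, by omega⟩
      have h2 : (A - B) % 2 ≠ 0 := fun e => h ⟨(A - B) / 2, by omega⟩
      omega
    obtain ⟨s, hs⟩ := this
    exact Or.inr ⟨_, key v r' a c ha hc s hs, by module⟩

theorem zero_mem_E8 : (0 : Fin 8 → ℚ) ∈ E8Set :=
  ⟨Or.inl fun _ => ⟨0, by simp⟩, 0, by simp⟩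

/-- The orthogonal complement is `II_{2,2+8k}`. -/
theorem complement_iso (N k : ℕ) (hN : N = 8 * k + 4) (w₁ w₂ : Fin (N + 2) → ℚ)
    (h₁ : w₁ ∈ LamSet N) (h₂ : w₂ ∈ LamSet N)
    (hs₁ : LamForm N w₁ w₁ = -2) (hs₂ : LamForm N w₂ w₂ = -2)
    (hd₁ : ∀ y ∈ LamSet N, ∃ n : ℤ, LamForm N w₁ y = 2 * n)
    (hd₂ : ∀ y ∈ LamSet N, ∃ n : ℤ, LamForm N w₂ y = 2 * n)
    (h12 : LamForm N w₁ w₂ = 0) :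
    ∃ F : IIAmb k →ₗ[ℚ] (Fin (N + 2) → ℚ),
      Function.Injective F ∧
      (∀ x y, LamForm N (F x) (F y) = IIForm k x y) ∧
      F '' IISet k =
        {x | x ∈ LamSet N ∧ LamForm N x w₁ = 0 ∧
          LamForm N x w₂ = 0} := by
  have hPhi : ∃ Φ : WAmb k ≃ₗ[ℚ] (Fin (N + 2) → ℚ),
      (∀ p q, LamForm N (Φ p) (Φ q) = WForm k p q) ∧
      ∀ p, Φ p ∈ LamSet N ↔
        (p.1 ∈ IISet k ∧ IntVec p.2 ∧ ∃ a : ℤ, ∑ i, p.2 i = 2 * (a : ℚ)) := by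
    subst hN
    exact exists_Phi k
  obtain ⟨Φ, hΦ, hmem⟩ := hPhi
  set r := Φ (0, ![1, 1]) with hr
  set r' := Φ (0, ![1, -1]) with hr'
  have memU : ∀ u : Fin 4 → ℚ, IntVec u → Φ ((u, 0), 0) ∈ LamSub N := by
    intro u hu
    refine (hmem _).2 ⟨⟨hu, fun j => zero_mem_E8⟩, fun _ => ⟨0, by simp⟩, 0, by simp⟩
  have memr : r ∈ LamSet N := by
    refine (hmem _).2 ⟨⟨fun _ => ⟨0, by simp⟩, fun j => zero_mem_E8⟩, ?_, 1, ?_⟩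
    · intro i; fin_cases i
      · exact ⟨1, by simp⟩
      · exact ⟨1, by simp⟩
    · simp [Fin.sum_univ_two]; norm_num
  have memr' : r' ∈ LamSet N := by
    refine (hmem _).2 ⟨⟨fun _ => ⟨0, by simp⟩, fun j => zero_mem_E8⟩, ?_, 0, ?_⟩
    · intro i; fin_cases i
      · exact ⟨1, by simp⟩
      · exact ⟨-1, by simp⟩
    · simp [Fin.sum_univ_two]
  have fr : ∀ q, LamForm N r (Φ q) = - (q.2 0 + q.2 1) := by
    intro q; rw [hr, hΦ]; simp [WForm, IIForm, UForm, negE, Fin.sum_univ_two]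
  have fr' : ∀ q, LamForm N r' (Φ q) = - (q.2 0 - q.2 1) := by
    intro q; rw [hr', hΦ]; simp [WForm, IIForm, UForm, negE, Fin.sum_univ_two]
    ring
  have srr : LamForm N r r = -2 := by rw [hr, fr]; simp; norm_num
  have srr' : LamForm N r' r' = -2 := by rw [hr', fr']; simp; norm_num
  have sro : LamForm N r r' = 0 := by rw [hr', fr]; simp
  have sro' : LamForm N r' r = 0 := by rw [hr, fr']; simp
  have dr : ∀ y ∈ LamSet N, ∃ n : ℤ, LamForm N r y = 2 * n := by
    intro y hy
    obtain ⟨q, rfl⟩ := Φ.surjective y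
    obtain ⟨-, -, a, ha⟩ := (hmem q).1 hy
    refine ⟨-a, ?_⟩
    rw [Fin.sum_univ_two] at ha
    rw [fr, ha]; push_cast; ring
  have dr' : ∀ y ∈ LamSet N, ∃ n : ℤ, LamForm N r' y = 2 * n := by
    intro y hy
    obtain ⟨q, rfl⟩ := Φ.surjective y
    obtain ⟨-, hi, a, ha⟩ := (hmem q).1 hy
    obtain ⟨b, hb⟩ := hi 1
    refine ⟨b - a, ?_⟩
    rw [Fin.sum_univ_two] at ha
    rw [fr', ← sub_eq_zero]; push_cast; rw [← hb]; linarith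
  have hcl := fun v (hv : v ∈ LamSub N) sv dv =>
    unigonal_class N (by omega) v r r' hv memr memr' sv srr srr' dv dr dr' sro
  have HP : ∀ y : Fin 2 → ℚ, HypPairs (LB N) (LamSub N) (Φ (0, y)) (Φ ((![1, 0, 0, 0], 0), 0))
      (Φ ((![0, 1, 0, 0], 0), 0)) (Φ ((![0, 0, 1, 0], 0), 0)) (Φ ((![0, 0, 0, 1], 0), 0)) := by
    intro y
    constructor
    · exact memU _ (fun i => ⟨![1, 0, 0, 0] i, by fin_cases i <;> simp⟩)
    · exact memU _ (fun i => ⟨![0, 1, 0, 0] i, by fin_cases i <;> simp⟩)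
    · exact memU _ (fun i => ⟨![0, 0, 1, 0] i, by fin_cases i <;> simp⟩)
    · exact memU _ (fun i => ⟨![0, 0, 0, 1] i, by fin_cases i <;> simp⟩)
    all_goals
      rw [LB_apply, hΦ]
      simp [WForm, IIForm, UForm, negE, Fin.sum_univ_two]
  have hg : ∃ g : (Fin (N + 2) → ℚ) ≃ₗ[ℚ] (Fin (N + 2) → ℚ),
      (∀ x y, LamForm N (g x) (g y) = LamForm N x y) ∧ (∀ x ∈ LamSet N, g x ∈ LamSet N) ∧
      (∀ x ∈ LamSet N, g.symm x ∈ LamSet N) ∧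
      ((g w₁ = r ∧ g w₂ = r') ∨ (g w₁ = r' ∧ g w₂ = r)) := by
    rcases hcl w₁ h₁ hs₁ hd₁ with h | h
    · obtain ⟨g, g1, g2, g3, g4, g5⟩ := two_step (LB N) (LamForm_symm N) (LamSub N)
        (fun x hx y hy => Lam_int N x y hx.1 hy.1) (fun x hx => Lam_even N x hx)
        r r' _ _ _ _ memr memr' srr srr' sro (HP _) (HP _) hcl w₁ w₂ h h₂ hs₁ hs₂ hd₁ hd₂ h12
      exact ⟨g, g1, g2, g3, Or.inl ⟨g4, g5⟩⟩
    · obtain ⟨g, g1, g2, g3, g4, g5⟩ := two_step (LB N) (LamForm_symm N) (LamSub N)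
        (fun x hx y hy => Lam_int N x y hx.1 hy.1) (fun x hx => Lam_even N x hx)
        r' r _ _ _ _ memr' memr srr' srr sro' (HP _) (HP _) (fun v hv sv dv => (hcl v hv sv dv).symm)
        w₁ w₂ h h₂ hs₁ hs₂ hd₁ hd₂ h12
      exact ⟨g, g1, g2, g3, Or.inr ⟨g4, g5⟩⟩
  obtain ⟨g, g1, g2, g3, g4⟩ := hg
  have horth : ∀ x, (LamForm N x w₁ = 0 ∧ LamForm N x w₂ = 0) ↔
      (LamForm N r (g x) = 0 ∧ LamForm N r' (g x) = 0) := by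
    intro x
    rw [← g1 x w₁, ← g1 x w₂, LamForm_symm N r, LamForm_symm N r']
    rcases g4 with ⟨e1, e2⟩ | ⟨e1, e2⟩
    · rw [e1, e2]
    · rw [e1, e2, and_comm]
  refine ⟨(g.symm.toLinearMap.comp Φ.toLinearMap).comp (LinearMap.inl ℚ _ _), ?_, ?_, ?_⟩
  · intro x y hxy
    simpa using hxy
  · intro x y
    rw [← g1]
    simp [hΦ, WForm, negE]
  · ext x
    constructor
    · rintro ⟨p, hp, rfl⟩
      refine ⟨?_, (horth _).2 ?_⟩
      · exact g3 _ ((hmem _).2 ⟨hp, fun _ => ⟨0, by simp⟩, 0, by simp⟩)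
      · simp [fr, fr']
    · rintro ⟨hx, hx'⟩
      obtain ⟨⟨p, y⟩, hq⟩ := Φ.surjective (g x)
      have hx2 := (horth x).1 hx'
      rw [← hq, fr, fr'] at hx2
      have hy : y = 0 := by
        ext i
        have a1 := hx2.1
        have a2 := hx2.2
        simp only at a1 a2
        fin_cases i
        · simp; linarith
        · simp; linarith
      subst hy
      have hgx := g2 x hx
      rw [← hq, hmem] at hgx
      refine ⟨p, hgx.1, ?_⟩
      simp [hq]

end Lattice

/-- Let `(Λ, ξ)` be a decorated `D`-lattice of dimension `N = 8k + 4`.  If `w₁, w₂` are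
non-proportional unigonal vectors (`wᵢ² = -2`, `div(wᵢ) = 2`) spanning a negative
definite sublattice, then `w₁ ⊥ w₂`, `⟨w₁, w₂⟩ ≅ D₂`, `Λ = ⟨w₁,w₂⟩ ⊕ ⟨w₁,w₂⟩^⊥` with
`⟨w₁,w₂⟩^⊥ ≅ II_{2,N-2} = U² ⊕ E₈^k`, and the classes `w₁*, w₂*` are the two distinct
elements of `A_Λ \ {0, ξ}`. -/
theorem statement11 (N : ℕ) (hN : 4 ≤ N) (hmod : N % 8 = 4)
    (ξv : Fin (N + 2) → ℚ) (hξ : IsDeco N ξv)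
    (w₁ w₂ : Fin (N + 2) → ℚ)
    (h₁ : w₁ ∈ LamSet N) (h₂ : w₂ ∈ LamSet N)
    (hs₁ : LamForm N w₁ w₁ = -2) (hs₂ : LamForm N w₂ w₂ = -2)
    (hd₁ : HasDiv N w₁ 2) (hd₂ : HasDiv N w₂ 2)
    (hindep : ∀ a b : ℚ, a • w₁ + b • w₂ = 0 → a = 0 ∧ b = 0)
    (hnegdef : ∀ a b : ℚ, ¬(a = 0 ∧ b = 0) →
      LamForm N (a • w₁ + b • w₂) (a • w₁ + b • w₂) < 0) :
    LamForm N w₁ w₂ = 0 ∧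
    (∃ G : (Fin 2 → ℚ) →ₗ[ℚ] (Fin (N + 2) → ℚ),
      Function.Injective G ∧
      (∀ x y, LamForm N (G x) (G y) = negE x y) ∧
      G '' DSet 2 = {z | ∃ a b : ℤ, z = (a : ℚ) • w₁ + (b : ℚ) • w₂}) ∧
    (∀ x ∈ LamSet N, ∃ a b : ℤ, ∃ y, y ∈ LamSet N ∧
      LamForm N y w₁ = 0 ∧ LamForm N y w₂ = 0 ∧
      x = (a : ℚ) • w₁ + (b : ℚ) • w₂ + y) ∧
    (∃ F : IIAmb (N / 8) →ₗ[ℚ] (Fin (N + 2) → ℚ),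
      Function.Injective F ∧
      (∀ x y, LamForm N (F x) (F y) = IIForm (N / 8) x y) ∧
      F '' IISet (N / 8) =
        {x | x ∈ LamSet N ∧ LamForm N x w₁ = 0 ∧ LamForm N x w₂ = 0}) ∧
    (1/2 : ℚ) • w₁ ∉ LamSet N ∧ (1/2 : ℚ) • w₂ ∉ LamSet N ∧
    (1/2 : ℚ) • w₁ - ξv ∉ LamSet N ∧ (1/2 : ℚ) • w₂ - ξv ∉ LamSet N ∧
    (1/2 : ℚ) • w₁ - (1/2 : ℚ) • w₂ ∉ LamSet N := by
  have e2 : ((2 : ℤ) : ℚ) = 2 := by norm_num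
  have d1 : ∀ y ∈ LamSet N, ∃ n : ℤ, LamForm N w₁ y = 2 * n := by
    intro y hy; obtain ⟨n, hn⟩ := hd₁.1 y hy; exact ⟨n, by rw [hn, e2]⟩
  have d2 : ∀ y ∈ LamSet N, ∃ n : ℤ, LamForm N w₂ y = 2 * n := by
    intro y hy; obtain ⟨n, hn⟩ := hd₂.1 y hy; exact ⟨n, by rw [hn, e2]⟩
  have h12 : LamForm N w₁ w₂ = 0 := by
    obtain ⟨n, hn⟩ := d1 w₂ h₂
    have n1 := hnegdef 1 1 (by simp)
    have n2 := hnegdef 1 (-1) (by simp)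
    have hn' : LamForm N w₂ w₁ = 2 * n := by rw [LamForm_symm, hn]
    simp only [← LB_apply] at hn hn' hs₁ hs₂ n1 n2
    simp only [map_add, map_smul, LinearMap.add_apply, LinearMap.smul_apply, smul_eq_mul,
      hs₁, hs₂, hn, hn'] at n1 n2
    have a1 : (n : ℚ) < 1 := by linarith
    have a2 : (-1 : ℚ) < n := by linarith
    have b1 : n < 1 := by exact_mod_cast a1
    have b2 : -1 < n := by exact_mod_cast a2
    have : n = 0 := by omega
    rw [← LB_apply, hn, this]; simp
  have h21 : LamForm N w₂ w₁ = 0 := by rw [LamForm_symm, h12]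
  have nohalf : ∀ w : Fin (N + 2) → ℚ, LamForm N w w = -2 → (1/2 : ℚ) • w ∉ LamSet N := by
    intro w hw h
    obtain ⟨n, hn⟩ := Lam_int N _ _ h.1 h.1
    rw [LamForm_smul_left, LamForm_symm, LamForm_smul_left, hw] at hn
    have h2 : (2 * n : ℚ) = -1 := by linarith
    have h3 : 2 * n = -1 := by exact_mod_cast h2
    omega
  have noxi : ∀ w : Fin (N + 2) → ℚ, LamForm N w w = -2 → (1/2 : ℚ) • w - ξv ∉ LamSet N := by
    intro w hw h
    obtain ⟨hx1, a, ha⟩ := hξ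
    obtain ⟨b, hb⟩ := hx1 _ h
    obtain ⟨c, hc⟩ := Lam_int N _ _ h.1 h.1
    have hsym : LamForm N w ξv = LamForm N ξv w := LamForm_symm _ _ _
    simp only [← LB_apply] at ha hb hc hw hsym
    simp only [map_sub, map_smul, LinearMap.sub_apply, LinearMap.smul_apply, smul_eq_mul,
      hw, ha, hsym] at hb hc
    have h2 : (2 * (c + 2 * b + 1 + 2 * a) : ℚ) = -1 := by linarith
    have h3 : 2 * (c + 2 * b + 1 + 2 * a) = -1 := by exact_mod_cast h2
    omega
  refine ⟨h12, ?_, ?_, ?_, nohalf w₁ hs₁, nohalf w₂ hs₂, noxi w₁ hs₁, noxi w₂ hs₂,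
    half_diff_not_mem N w₁ w₂ hs₁ hs₂ h12⟩
  · let p0 : (Fin 2 → ℚ) →ₗ[ℚ] ℚ := LinearMap.proj 0
    let p1 : (Fin 2 → ℚ) →ₗ[ℚ] ℚ := LinearMap.proj 1
    let G : (Fin 2 → ℚ) →ₗ[ℚ] (Fin (N + 2) → ℚ) :=
      ((1/2 : ℚ) • (p0 + p1)).smulRight w₁ + ((1/2 : ℚ) • (p0 - p1)).smulRight w₂
    have hG : ∀ x, G x = ((x 0 + x 1) / 2) • w₁ + ((x 0 - x 1) / 2) • w₂ := by
      intro x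
      simp only [G, p0, p1, LinearMap.add_apply, LinearMap.smulRight_apply, LinearMap.smul_apply,
        LinearMap.sub_apply, LinearMap.proj_apply, smul_eq_mul]
      congr 2 <;> ring
    refine ⟨G, ?_, ?_, ?_⟩
    · rw [injective_iff_map_eq_zero]
      intro x hx
      rw [hG] at hx
      obtain ⟨a1, a2⟩ := hindep _ _ hx
      ext i
      fin_cases i
      · simp; linarith
      · simp; linarith
    · intro x y
      rw [hG, hG]
      simp only [← LB_apply] at h12 h21 hs₁ hs₂ ⊢
      simp only [map_add, map_smul, LinearMap.add_apply, LinearMap.smul_apply, smul_eq_mul,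
        hs₁, hs₂, h12, h21, negE, Fin.sum_univ_two]
      ring
    · ext z
      constructor
      · rintro ⟨x, ⟨hx, a, ha⟩, rfl⟩
        obtain ⟨c, hc⟩ := hx 1
        rw [Fin.sum_univ_two] at ha
        refine ⟨a, a - c, ?_⟩
        rw [hG]
        congr 2
        · linarith
        · push_cast; linarith
      · rintro ⟨a, b, rfl⟩
        refine ⟨![(a + b : ℚ), (a - b : ℚ)], ⟨?_, a, ?_⟩, ?_⟩
        · intro i
          fin_cases i
          · exact ⟨a + b, by simp⟩
          · exact ⟨a - b, by simp⟩
        · simp [Fin.sum_univ_two]; ring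
        · rw [hG]
          congr 2
          · simp
          · simp
  · intro x hx
    obtain ⟨m, hm⟩ := d1 x hx
    obtain ⟨n, hn⟩ := d2 x hx
    refine ⟨-m, -n, x + (m : ℚ) • w₁ + (n : ℚ) • w₂, ?_, ?_, ?_, ?_⟩
    · exact (LamSub N).add_mem ((LamSub N).add_mem hx (int_smul_mem _ h₁ _ m rfl))
        (int_smul_mem _ h₂ _ n rfl)
    · rw [LamForm_add_left, LamForm_add_left, LamForm_smul_left, LamForm_smul_left, hs₁, h21,
        LamForm_symm, hm]
      ring
    · rw [LamForm_add_left, LamForm_add_left, LamForm_smul_left, LamForm_smul_left, hs₂, h12,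
        LamForm_symm, hn]
      ring
    · push_cast; module
  · obtain ⟨k, hk⟩ : ∃ k, N / 8 = k := ⟨_, rfl⟩
    have hNk : N = 8 * k + 4 := by omega
    rw [hk]
    exact complement_iso N k hNk w₁ w₂ h₁ h₂ hs₁ hs₂ d1 d2 h12
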